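/- arXiv:2007.14120 — 4 statements merged into one kernel-verified Lean document; each statement's English description precedes it below -/
import Mathlib

section
/- Let Z = (c | G) be a zonotope in ℝ^D with generators g_1,…,g_n, let R_k ⊆ {1,…,D}, and let S_k = {p ∈ Z | p_d ≤ 0 for all d ∈ R_k and p_d ≥ 0 for all d ∉ R_k}. For each generator index j and each dimension d define t⁺_{j,d} = c_d − 2|g_{j,d}| + Σ_i |g_{i,d}| and t⁻_{j,d} = c_d + 2|g_{j,d}| − Σ_i |g_{i,d}|, and set α_{j,d} = 1 − |t⁺_{j,d}|/(2|g_{j,d}|) if d ∉ R_k, t⁺_{j,d} < 0 and g_{j,d} ≠ 0, α_{j,d} = 1 − |t⁻_{j,d}|/(2|g_{j,d}|) if d ∈ R_k, t⁻_{j,d} > 0 and g_{j,d} ≠ 0, and α_{j,d} = 1 otherwise. Let α_j = min_d α_{j,d}, let d*_j be a dimension attaining this minimum, let o_j = g_{j,d*_j}/|g_{j,d*_j}| if g_{j,d*_j} ≠ 0 (and o_j = 1 otherwise), and let s_j = 1 if d*_j ∉ R_k and s_j = −1 if d*_j ∈ R_k. Define the zonotope Ẑ_k with generators ĝ_j = α_j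 g_j and center ĉ = c + Σ_j s_j (1 − α_j) o_j g_j. Then S_k ⊆ Ẑ_k. -/
/-- The zonotope with center `c` and generators `g 0, …, g (n-1)`:
the set of points `c + ∑ i, β i • g i` with `β i ∈ [-1, 1]`. -/
def zonotope {D n : ℕ} (c : Fin D → ℝ) (g : Fin n → Fin D → ℝ) : Set (Fin D → ℝ) :=
  {p | ∃ β : Fin n → ℝ, (∀ i, β i ∈ Set.Icc (-1 : ℝ) 1) ∧ p = c + ∑ i, β i • g i}

/-- Coordinatewise ReLU. -/
def relu {D : ℕ} (x : Fin D → ℝ) : Fin D → ℝ := fun d => max 0 (x d)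

/-- Projection to zero in the dimensions belonging to `M`. -/
def proj {D : ℕ} (M : Finset (Fin D)) (x : Fin D → ℝ) : Fin D → ℝ :=
  fun d => if d ∈ M then 0 else x d

/-- All terms of a `[-1, 1]`-weighted sum except one are bounded by their absolute values. -/
theorem sum_mul_le_add_sum_abs_sub {ι : Type*} [Fintype ι] (β x : ι → ℝ)
    (hβ : ∀ i, β i ∈ Set.Icc (-1 : ℝ) 1) (j : ι) :
    ∑ i, β i * x i ≤ β j * x j + ∑ i, |x i| - |x j| := by
  have hle : ∀ i, β i * x i ≤ |x i| := fun i =>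
    calc β i * x i ≤ |β i * x i| := le_abs_self _
      _ = |β i| * |x i| := abs_mul _ _
      _ ≤ |x i| := mul_le_of_le_one_left (abs_nonneg _) (abs_le.2 (hβ i))
  have := Finset.single_le_sum (f := fun i => |x i| - β i * x i)
    (fun i _ => sub_nonneg.2 (hle i)) (Finset.mem_univ j)
  rw [Finset.sum_sub_distrib] at this
  linarith

/-- A coefficient `b ∈ [-1, 1]` with `b * a ≥ -t - |a|`, where `t < 0`, lies in an interval of
radius `1 - |t| / (2 * |a|)`. -/
theorem abs_sub_sign_le {a b t : ℝ} (ha : a ≠ 0) (hb : |b| ≤ 1) (ht : t < 0)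
    (h : 0 ≤ t + |a| + b * a) :
    |b - |t| / (2 * |a|) * (a / |a|)| ≤ 1 - |t| / (2 * |a|) := by
  obtain ⟨hb₁, hb₂⟩ := abs_le.1 hb
  rw [abs_of_neg ht]
  obtain ⟨r, hr⟩ : ∃ r, r = -t / (2 * |a|) := ⟨_, rfl⟩
  have hpos : 0 < |a| := abs_pos.2 ha
  have hrt : t = -(2 * r * |a|) := by rw [hr]; field_simp
  rw [← hr, abs_le]
  rw [hrt] at h
  rcases lt_or_gt_of_ne ha with ha' | ha'
  · rw [abs_of_neg ha'] at h ⊢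
    rw [div_neg, div_self ha]
    have : 0 ≤ 1 - b - 2 * r := by
      by_contra! hneg
      nlinarith
    constructor <;> linarith
  · rw [abs_of_pos ha'] at h ⊢
    rw [div_self ha]
    have : 0 ≤ 1 + b - 2 * r := by
      by_contra! hneg
      nlinarith
    constructor <;> linarith

/-- A point of a zonotope whose coefficients lie in the intervals of centers `m j` and radii `α j`
belongs to the zonotope with scaled generators and shifted center. -/
theorem mem_zonotope_shift {D n : ℕ} (c : Fin D → ℝ) (g : Fin n → Fin D → ℝ)
    (β m α : Fin n → ℝ) (h : ∀ j, |β j - m j| ≤ α j) :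
    c + ∑ j, β j • g j ∈ zonotope (c + ∑ j, m j • g j) (fun j => α j • g j) := by
  refine ⟨fun j => (β j - m j) / α j, fun j => ?_, ?_⟩
  · have hα : 0 ≤ α j := (abs_nonneg _).trans (h j)
    refine abs_le.1 ?_
    rw [abs_div, abs_of_nonneg hα]
    exact div_le_one_of_le₀ (h j) hα
  · rw [add_assoc, ← Finset.sum_add_distrib]
    congr 1
    refine Finset.sum_congr rfl fun j _ => ?_
    rw [smul_smul, ← add_smul, div_mul_cancel_of_imp, add_sub_cancel]
    intro h0
    have := h j
    rw [h0] at this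
    exact abs_nonpos_iff.1 this

/-- Theorem 2 of the paper: the over-approximating zonotope obtained by scaling the
generators by the analytically computed factors contains the quadrant piece `S_k`. -/
theorem over_approx_superset {D n : ℕ} (c : Fin D → ℝ) (g : Fin n → Fin D → ℝ)
    (Rk : Finset (Fin D))
    (tp tm : Fin n → Fin D → ℝ)
    (htp : ∀ j d, tp j d = c d - 2 * |g j d| + ∑ i, |g i d|)
    (htm : ∀ j d, tm j d = c d + 2 * |g j d| - ∑ i, |g i d|)
    (αf : Fin n → Fin D → ℝ)
    (hαf : ∀ j d, αf j d =
      if d ∉ Rk ∧ tp j d < 0 ∧ g j d ≠ 0 then 1 - |tp j d| / (2 * |g j d|)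
      else if d ∈ Rk ∧ 0 < tm j d ∧ g j d ≠ 0 then 1 - |tm j d| / (2 * |g j d|)
      else 1)
    (dstar : Fin n → Fin D)
    (hdstar : ∀ j d, αf j (dstar j) ≤ αf j d)
    (α : Fin n → ℝ) (hα : ∀ j, α j = αf j (dstar j))
    (o : Fin n → ℝ)
    (ho : ∀ j, o j = if g j (dstar j) ≠ 0 then g j (dstar j) / |g j (dstar j)| else 1)
    (s : Fin n → ℝ) (hs : ∀ j, s j = if dstar j ∈ Rk then -1 else 1)
    (ghat : Fin n → Fin D → ℝ) (hghat : ∀ j, ghat j = α j • g j)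
    (chat : Fin D → ℝ) (hchat : chat = c + ∑ j, (s j * (1 - α j) * o j) • g j) :
    {p ∈ zonotope c g | (∀ d ∈ Rk, p d ≤ 0) ∧ (∀ d ∉ Rk, 0 ≤ p d)}
      ⊆ zonotope chat ghat := by
  rintro p ⟨⟨β, hβ, rfl⟩, hneg, hpos⟩
  rw [hchat, show ghat = fun j => α j • g j from funext hghat]
  refine mem_zonotope_shift c g β _ α fun j => ?_
  have hb : |β j| ≤ 1 := abs_le.2 (hβ j)
  have hαj := (hα j).trans (hαf j (dstar j))
  rw [hs, ho]
  generalize dstar j = d at hαj ⊢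
  split_ifs at hαj with h₁ h₂
  · obtain ⟨hd, ht, hg⟩ := h₁
    have hp := hpos d hd
    simp only [Pi.add_apply, Finset.sum_apply, Pi.smul_apply, smul_eq_mul] at hp
    have hsum := sum_mul_le_add_sum_abs_sub β (fun i => g i d) hβ j
    have key := abs_sub_sign_le hg hb ht (by rw [htp]; linarith)
    rw [if_neg hd, if_pos hg, hαj, sub_sub_cancel, one_mul]
    exact key
  · obtain ⟨hd, ht, hg⟩ := h₂
    have hp := hneg d hd
    simp only [Pi.add_apply, Finset.sum_apply, Pi.smul_apply, smul_eq_mul] at hp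
    have hsum := sum_mul_le_add_sum_abs_sub β (fun i => -g i d) hβ j
    simp only [abs_neg, mul_neg, Finset.sum_neg_distrib] at hsum
    have key := abs_sub_sign_le hg ((abs_neg (β j)).trans_le hb) (neg_lt_zero.2 ht)
      (by rw [htm]; linarith)
    rw [if_pos hd, if_pos hg, hαj, sub_sub_cancel, ← abs_neg]
    rw [abs_neg (tm j d)] at key
    convert key using 2
    ring
  · simpa [hαj] using hb
end

section
/- Let Z = (c | G) be a zonotope in ℝ^D with generators g_1,…,g_n, and let p = c + Σ_i β_i g_i with β_i ∈ [−1,1] for all i. Fix a dimension d and a generator index j with g_{j,d} ≠ 0, and suppose p_d ≥ 0 and t⁺ := c_d − 2|g_{j,d}| + Σ_i |g_{i,d}| < 0. Set α = 1 − |t⁺|/(2|g_{j,d}|) and β' = β_j · (g_{j,d}/|g_{j,d}|). Then 2(1 − α) − 1 ≤ β'. -/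
/-- Lemma 2 of the paper: lower bound on the scaled coefficient. -/
theorem over_approx_const_one {D n : ℕ} (c : Fin D → ℝ) (g : Fin n → Fin D → ℝ)
    (β : Fin n → ℝ) (hβ : ∀ i, β i ∈ Set.Icc (-1 : ℝ) 1)
    (p : Fin D → ℝ) (hp : p = c + ∑ i, β i • g i)
    (d : Fin D) (j : Fin n) (hg : g j d ≠ 0)
    (hpd : 0 ≤ p d)
    (tp : ℝ) (htp : tp = c d - 2 * |g j d| + ∑ i, |g i d|)
    (htpneg : tp < 0)
    (α : ℝ) (hα : α = 1 - |tp| / (2 * |g j d|))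
    (β' : ℝ) (hβ' : β' = β j * (g j d / |g j d|)) :
    2 * (1 - α) - 1 ≤ β' := by
  have hsum : ∑ i ∈ Finset.univ.erase j, β i * g i d ≤ ∑ i ∈ Finset.univ.erase j, |g i d| := by
    refine Finset.sum_le_sum fun i _ => (le_abs_self _).trans ?_
    rw [abs_mul]
    exact mul_le_of_le_one_left (abs_nonneg _) (abs_le.mpr (hβ i))
  have hpos : 0 < |g j d| := abs_pos.mpr hg
  have hp_coord : p d = c d + ∑ i, β i * g i d := by
    simp [hp, Finset.sum_apply]
  have hβg := Finset.add_sum_erase Finset.univ (fun i => β i * g i d) (Finset.mem_univ j)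
  have habs := Finset.add_sum_erase Finset.univ (fun i => |g i d|) (Finset.mem_univ j)
  have key : -tp - |g j d| ≤ β j * g j d := by linarith
  have hlhs : 2 * (1 - α) - 1 = (-tp - |g j d|) / |g j d| := by
    rw [hα, abs_of_neg htpneg]
    field_simp
    ring
  rw [hlhs, hβ', ← mul_div_assoc]
  exact div_le_div_of_nonneg_right key hpos.le
end

section
/- Let Z = (c | G) be a zonotope in ℝ^D with generators g_1,…,g_n, and let p = c + Σ_i β_i g_i with β_i ∈ [−1,1] for all i. Fix a dimension d and a generator index j with g_{j,d} ≠ 0, and suppose p_d ≤ 0 and t⁻ := c_d + 2|g_{j,d}| − Σ_i |g_{i,d}| > 0. Set α = 1 − |t⁻|/(2|g_{j,d}|) and β' = β_j · (g_{j,d}/|g_{j,d}|). Then β' ≤ 1 − 2(1 − α). -/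
/-- Lemma 3 of the paper: upper bound on the scaled coefficient. -/
theorem over_approx_const_two {D n : ℕ} (c : Fin D → ℝ) (g : Fin n → Fin D → ℝ)
    (β : Fin n → ℝ) (hβ : ∀ i, β i ∈ Set.Icc (-1 : ℝ) 1)
    (p : Fin D → ℝ) (hp : p = c + ∑ i, β i • g i)
    (d : Fin D) (j : Fin n) (hg : g j d ≠ 0)
    (hpd : p d ≤ 0)
    (tm : ℝ) (htm : tm = c d + 2 * |g j d| - ∑ i, |g i d|)
    (htmpos : 0 < tm)
    (α : ℝ) (hα : α = 1 - |tm| / (2 * |g j d|))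
    (β' : ℝ) (hβ' : β' = β j * (g j d / |g j d|)) :
    β' ≤ 1 - 2 * (1 - α) := by
  have hpos : 0 < |g j d| := abs_pos.mpr hg
  have hpd_eq : p d = c d + ∑ i, β i * g i d := by
    simp [hp, Finset.sum_apply]
  have hnonneg : ∀ i, 0 ≤ β i * g i d + |g i d| := fun i => by
    have h : |β i * g i d| ≤ |g i d| := by
      rw [abs_mul]
      exact mul_le_of_le_one_left (abs_nonneg _) (abs_le.mpr (hβ i))
    linarith [neg_abs_le (β i * g i d)]
  have hle : β j * g j d + |g j d| ≤ ∑ i, (β i * g i d + |g i d|) :=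
    Finset.single_le_sum (f := fun i => β i * g i d + |g i d|)
      (fun i _ => hnonneg i) (Finset.mem_univ j)
  rw [Finset.sum_add_distrib] at hle
  have hkey : β j * g j d ≤ |g j d| - tm := by linarith
  have hrhs : 1 - 2 * (1 - α) = (|g j d| - tm) / |g j d| := by
    rw [hα, abs_of_pos htmpos]
    field_simp
    ring
  rw [hβ', hrhs, ← mul_div_assoc]
  exact div_le_div_of_nonneg_right hkey hpos.le
end

section
/- Let Z = (c | G) be a zonotope in ℝ^D with generators g_1,…,g_n, let R_k ⊆ {1,…,D}, and let S_k = {p ∈ Z | p_d ≤ 0 for all d ∈ R_k and p_d ≥ 0 for all d ∉ R_k}. Suppose Ẑ_k is the zonotope with generators ĝ_i = α_i g_i and center ĉ = c + Σ_i δ_i g_i, where for every i: α_i ∈ [0,1] and |δ_i| ≤ 1 − α_i, and additionally ĉ_d − Σ_i |ĝ_{i,d}| ≥ 0 for all d ∉ R_k and ĉ_d + Σ_i |ĝ_{i,d}| ≤ 0 for all d ∈ R_k. Then Ẑ_k ⊆ S_k. -/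
/-- Each coordinate of a point of a zonotope differs from that of the center by at most the
sum of the absolute values of the generators' coordinates. -/
theorem abs_sub_center_le_of_mem_zonotope {D n : ℕ} {c : Fin D → ℝ} {g : Fin n → Fin D → ℝ}
    {p : Fin D → ℝ} (hp : p ∈ zonotope c g) (d : Fin D) :
    |p d - c d| ≤ ∑ i, |g i d| := by
  obtain ⟨β, hβ, rfl⟩ := hp
  simp only [Pi.add_apply, Finset.sum_apply, Pi.smul_apply, smul_eq_mul, add_sub_cancel_left]
  refine (Finset.abs_sum_le_sum_abs _ _).trans (Finset.sum_le_sum fun i _ => ?_)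
  rw [abs_mul]
  exact mul_le_of_le_one_left (abs_nonneg _) (abs_le.2 (hβ i))

/-- Scaling the generators by `α i` and shifting the center by `∑ i, δ i • g i` with
`|δ i| ≤ 1 - α i` yields a subset of the original zonotope. -/
theorem zonotope_scale_shift_subset {D n : ℕ} (c : Fin D → ℝ) (g : Fin n → Fin D → ℝ)
    (α δ : Fin n → ℝ) (hα : ∀ i, 0 ≤ α i) (hδ : ∀ i, |δ i| ≤ 1 - α i) :
    zonotope (c + ∑ i, δ i • g i) (fun i => α i • g i) ⊆ zonotope c g := by
  rintro _ ⟨β, hβ, rfl⟩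
  refine ⟨fun i => δ i + β i * α i, fun i => ?_, ?_⟩
  · obtain ⟨hδl, hδu⟩ := abs_le.1 (hδ i)
    obtain ⟨hβl, hβu⟩ := hβ i
    have hl := mul_le_mul_of_nonneg_right hβl (hα i)
    have hu := mul_le_mul_of_nonneg_right hβu (hα i)
    constructor <;> linarith
  · simp only [add_smul, mul_smul, Finset.sum_add_distrib, add_assoc]

/-- Theorem 3 of the paper: the under-approximating zonotope obtained from the linear
program is contained in the quadrant piece `S_k`. -/
theorem under_approx_subset {D n : ℕ} (c : Fin D → ℝ) (g : Fin n → Fin D → ℝ)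
    (Rk : Finset (Fin D))
    (α δ : Fin n → ℝ)
    (hα : ∀ i, α i ∈ Set.Icc (0 : ℝ) 1) (hδ : ∀ i, |δ i| ≤ 1 - α i)
    (ghat : Fin n → Fin D → ℝ) (hghat : ∀ i, ghat i = α i • g i)
    (chat : Fin D → ℝ) (hchat : chat = c + ∑ i, δ i • g i)
    (hlow : ∀ d ∉ Rk, 0 ≤ chat d - ∑ i, |ghat i d|)
    (hupp : ∀ d ∈ Rk, chat d + ∑ i, |ghat i d| ≤ 0) :
    zonotope chat ghat
      ⊆ {p ∈ zonotope c g | (∀ d ∈ Rk, p d ≤ 0) ∧ (∀ d ∉ Rk, 0 ≤ p d)} := by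
  obtain rfl : ghat = fun i => α i • g i := funext hghat
  subst hchat
  intro p hp
  refine ⟨zonotope_scale_shift_subset c g α δ (fun i => (hα i).1) hδ hp,
    fun d hd => ?_, fun d hd => ?_⟩
  · have h := (abs_le.1 (abs_sub_center_le_of_mem_zonotope hp d)).2
    linarith [hupp d hd]
  · have h := (abs_le.1 (abs_sub_center_le_of_mem_zonotope hp d)).1
    linarith [hlow d hd]
end
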